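/- Let k ≥ 1 be an integer and Z a real Banach space. For every pair of neighbourhoods Ũ, Ṽ of the origin in ℝ^k × Z there exists ỹ ∈ Ṽ such that the equation w_{k,Z}(x) = ỹ has exactly k+1 pairwise distinct solutions in ℝ^k × Z, all of which lie in Ũ, and at each solution x̂ the Fréchet derivative w_{k,Z}'(x̂) : ℝ^k × Z → ℝ^k × Z is a continuous linear isomorphism. -/

import Mathlib

/-- The Whitney map `w_k : ℝ^k → ℝ^k`. -/
noncomputable def whitney (k : ℕ) (hk : 0 < k) (x : Fin k → ℝ) : Fin k → ℝ :=
  fun j => if (j : ℕ) = 0 then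
      (x ⟨0, hk⟩) ^ (k + 1) +
        ∑ i : Fin k, (if (i : ℕ) = 0 then 0 else x i * (x ⟨0, hk⟩) ^ (i : ℕ))
    else x j

/-- The generalized Whitney map `w_{k,Z} : ℝ^k × Z → ℝ^k × Z`, `(t, z) ↦ (w_k t, z)`. -/
noncomputable def whitneyZ (k : ℕ) (hk : 0 < k) (Z : Type*) [NormedAddCommGroup Z]
    [NormedSpace ℝ Z] (p : (Fin k → ℝ) × Z) : (Fin k → ℝ) × Z :=
  (whitney k hk p.1, p.2)

open Polynomial Filter Topology

/-- The point `(t, c₁, …, c_{k-1})` of `ℝ^k`. -/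
def whitneyPoint (k : ℕ) (t : ℝ) (c : ℕ → ℝ) : Fin k → ℝ :=
  fun j => if (j : ℕ) = 0 then t else c j

theorem whitneyPoint_zero {k : ℕ} (hk : 0 < k) (t : ℝ) (c : ℕ → ℝ) :
    whitneyPoint k t c ⟨0, hk⟩ = t := by
  simp [whitneyPoint]

theorem Polynomial.Monic.eval_eq_of_coeff_eq_zero {k : ℕ} {Q : ℝ[X]} (hm : Q.Monic)
    (hd : Q.natDegree = k + 1) (hc : Q.coeff k = 0) (t : ℝ) :
    Q.eval t = t ^ (k + 1) + ∑ i : Fin k, Q.coeff i * t ^ (i : ℕ) := by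
  have hlead : Q.coeff (k + 1) = 1 := hd ▸ hm.coeff_natDegree
  rw [eval_eq_sum_range, hd, Finset.sum_range_succ, Finset.sum_range_succ, hc, hlead,
    Fin.sum_univ_eq_sum_range (fun i => Q.coeff i * t ^ i) k]
  ring

theorem whitney_whitneyPoint {k : ℕ} (hk : 0 < k) {Q : ℝ[X]} (hm : Q.Monic)
    (hd : Q.natDegree = k + 1) (hc : Q.coeff k = 0) (t : ℝ) :
    whitney k hk (whitneyPoint k t Q.coeff) =
      whitneyPoint k (Q.eval t - Q.coeff 0) Q.coeff := by
  funext j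
  by_cases hj : (j : ℕ) = 0
  · obtain rfl : j = ⟨0, hk⟩ := Fin.ext hj
    simp only [whitney, if_true, whitneyPoint_zero, hm.eval_eq_of_coeff_eq_zero hd hc]
    obtain ⟨m, rfl⟩ := Nat.exists_eq_succ_of_ne_zero hk.ne'
    simp [whitneyPoint, Fin.sum_univ_succ]
    ring
  · simp [whitney, whitneyPoint, hj]

theorem eq_whitneyPoint_of_whitney_eq {k : ℕ} (hk : 0 < k) {x : Fin k → ℝ} {b : ℝ}
    {c : ℕ → ℝ} (h : whitney k hk x = whitneyPoint k b c) :
    x = whitneyPoint k (x ⟨0, hk⟩) c := by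
  funext j
  by_cases hj : (j : ℕ) = 0
  · obtain rfl : j = ⟨0, hk⟩ := Fin.ext hj
    simp [whitneyPoint]
  · simpa [whitney, whitneyPoint, hj] using congrFun h j

theorem hasDerivAt_whitneyPoint {k : ℕ} (hk : 0 < k) (t : ℝ) (c : ℕ → ℝ) :
    HasDerivAt (fun s => whitneyPoint k s c) (Pi.single ⟨0, hk⟩ 1) t := by
  rw [hasDerivAt_pi]
  intro j
  by_cases hj : (j : ℕ) = 0
  · obtain rfl : j = ⟨0, hk⟩ := Fin.ext hj
    simpa [whitneyPoint] using hasDerivAt_id' t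
  · have hne : j ≠ ⟨0, hk⟩ := fun h => hj (by simp [h])
    simpa [whitneyPoint, hj, hne] using hasDerivAt_const t (c j)

theorem differentiable_whitney (k : ℕ) (hk : 0 < k) : Differentiable ℝ (whitney k hk) := by
  rw [differentiable_pi]
  intro j
  by_cases hj : (j : ℕ) = 0
  · simp only [whitney, hj, if_true]
    refine Differentiable.add (by fun_prop) (Differentiable.fun_sum fun i _ => ?_)
    by_cases hi : (i : ℕ) = 0
    · simp [hi]
    · simp only [hi, if_false]
      fun_prop
  · simp only [whitney, hj, if_false]
    fun_prop

theorem fderiv_whitney_apply_of_ne {k : ℕ} (hk : 0 < k) (x v : Fin k → ℝ) {j : Fin k}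
    (hj : (j : ℕ) ≠ 0) : fderiv ℝ (whitney k hk) x v j = v j := by
  have h := hasFDerivAt_pi'.1 (differentiable_whitney k hk x).hasFDerivAt j
  have h' : HasFDerivAt (fun x => whitney k hk x j)
      (ContinuousLinearMap.proj j : (Fin k → ℝ) →L[ℝ] ℝ) x := by
    simp only [whitney, hj, if_false]
    exact hasFDerivAt_apply j x
  simpa using DFunLike.congr_fun (h.unique h') v

theorem fderiv_whitney_single {k : ℕ} (hk : 0 < k) {Q : ℝ[X]} (hm : Q.Monic)
    (hd : Q.natDegree = k + 1) (hc : Q.coeff k = 0) (t : ℝ) :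
    fderiv ℝ (whitney k hk) (whitneyPoint k t Q.coeff) (Pi.single ⟨0, hk⟩ 1) ⟨0, hk⟩ =
      Q.derivative.eval t := by
  have h := (differentiable_whitney k hk (whitneyPoint k t Q.coeff)).hasFDerivAt.comp_hasDerivAt
    t (hasDerivAt_whitneyPoint hk t Q.coeff)
  have h₀ := hasDerivAt_pi.1 h ⟨0, hk⟩
  have h' : HasDerivAt (fun s => Q.eval s - Q.coeff 0) (Q.derivative.eval t) t :=
    (Q.hasDerivAt t).sub_const _
  refine h₀.unique (h'.congr_of_eventuallyEq (Eventually.of_forall fun s => ?_))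
  simp [whitney_whitneyPoint hk hm hd hc, whitneyPoint_zero]

/-- A linear endomorphism of `ι → ℝ` preserving all coordinates but one is bijective when it
acts nontrivially on the remaining coordinate direction. -/
theorem LinearMap.bijective_of_apply_eq_of_ne {ι : Type*} [DecidableEq ι]
    (L : (ι → ℝ) →ₗ[ℝ] (ι → ℝ)) (o : ι) (hL : ∀ v, ∀ j ≠ o, L v j = v j)
    (ho : L (Pi.single o 1) o ≠ 0) : Function.Bijective L := by
  constructor
  · rw [injective_iff_map_eq_zero]
    intro v hv
    have hvo : v = v o • Pi.single o 1 := by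
      funext j
      by_cases hj : j = o
      · subst hj
        simp
      · simp [hj, ← hL v j hj, hv]
    have h := congrFun hv o
    rw [hvo, map_smul] at h
    have hz : v o = 0 := by simpa [ho] using h
    rw [hvo, hz, zero_smul]
  · intro w
    refine ⟨w + ((w o - L w o) / L (Pi.single o 1) o) • Pi.single o 1, ?_⟩
    funext j
    by_cases hj : j = o
    · subst hj
      simp [ho]
    · simp [hL, hj]

theorem exists_equiv_eq_fderiv_whitneyZ {k : ℕ} (hk : 0 < k) {Z : Type*} [NormedAddCommGroup Z]
    [NormedSpace ℝ Z] {Q : ℝ[X]} (hm : Q.Monic) (hd : Q.natDegree = k + 1)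
    (hc : Q.coeff k = 0) {t : ℝ} (ht : Q.derivative.eval t ≠ 0) (z : Z) :
    ∃ e : ((Fin k → ℝ) × Z) ≃L[ℝ] ((Fin k → ℝ) × Z),
      (e : ((Fin k → ℝ) × Z) →L[ℝ] ((Fin k → ℝ) × Z)) =
        fderiv ℝ (whitneyZ k hk Z) (whitneyPoint k t Q.coeff, z) := by
  set L := fderiv ℝ (whitney k hk) (whitneyPoint k t Q.coeff) with hLdef
  have hbij : Function.Bijective L.toLinearMap :=
    LinearMap.bijective_of_apply_eq_of_ne L.toLinearMap ⟨0, hk⟩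
      (fun v j hj => fderiv_whitney_apply_of_ne hk _ v fun h => hj (Fin.ext h))
      (by simpa only [hLdef, ContinuousLinearMap.coe_coe, fderiv_whitney_single hk hm hd hc])
  have hZ : HasFDerivAt (whitneyZ k hk Z) (L.prodMap (ContinuousLinearMap.id ℝ Z))
      (whitneyPoint k t Q.coeff, z) :=
    HasFDerivAt.prodMap (whitneyPoint k t Q.coeff, z) (f := whitney k hk) (f₂ := id)
      (differentiable_whitney k hk _).hasFDerivAt (hasFDerivAt_id z)
  let e := (LinearEquiv.ofBijective L.toLinearMap hbij).toContinuousLinearEquiv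
  refine ⟨e.prodCongr (ContinuousLinearEquiv.refl ℝ Z), ?_⟩
  rw [hZ.fderiv]
  rfl

theorem continuous_coeff_prod_X_sub_C {ι : Type*} (S : Finset ι) (a : ι → ℝ) (j : ℕ) :
    Continuous fun s : ℝ => (∏ i ∈ S, (X - C (s * a i))).coeff j := by
  classical
  induction S using Finset.induction_on generalizing j with
  | empty => simpa using continuous_const
  | insert i S hi ih =>
    simp only [Finset.prod_insert hi, coeff_mul, coeff_sub, coeff_C]
    refine continuous_finsetSum _ fun p _ => Continuous.mul ?_ (ih _)
    split_ifs <;> fun_prop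

theorem continuous_whitneyPoint {k : ℕ} {t : ℝ → ℝ} {c : ℝ → ℕ → ℝ} (ht : Continuous t)
    (hc : ∀ j, Continuous fun s => c s j) :
    Continuous fun s => whitneyPoint k (t s) (c s) := by
  refine continuous_pi fun j => ?_
  simp only [whitneyPoint]
  split_ifs
  exacts [ht, hc _]

theorem sum_natCast_sub_half_eq_zero (k : ℕ) :
    ∑ i : Fin (k + 1), ((i : ℝ) - k / 2) = 0 := by
  rw [Fin.sum_univ_eq_sum_range (fun i => (i : ℝ) - k / 2)]
  induction k with
  | zero => simp
  | succ n ih =>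
    rw [Finset.sum_sub_distrib] at ih ⊢
    rw [Finset.sum_range_succ]
    simp only [Finset.sum_const, Finset.card_range, nsmul_eq_mul] at ih ⊢
    push_cast at ih ⊢
    linarith

/-- Let `k ≥ 1` and `Z` a real Banach space.  For every pair of
neighbourhoods `U, V` of the origin in `ℝ^k × Z` there exists `y ∈ V` such that the equation
`w_{k,Z} x = y` has exactly `k+1` pairwise distinct solutions, all lying in `U`, and at each
solution the Fréchet derivative of `w_{k,Z}` is a continuous linear isomorphism. -/
theorem whitneyZ_exact_solutions (k : ℕ) (hk : 0 < k) (Z : Type*) [NormedAddCommGroup Z]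
    [NormedSpace ℝ Z] [CompleteSpace Z] (U V : Set ((Fin k → ℝ) × Z))
    (hU : U ∈ nhds (0 : (Fin k → ℝ) × Z)) (hV : V ∈ nhds (0 : (Fin k → ℝ) × Z)) :
    ∃ y ∈ V, ∃ p : Fin (k + 1) → (Fin k → ℝ) × Z,
      Function.Injective p ∧
      (∀ i : Fin (k + 1), p i ∈ U ∧ whitneyZ k hk Z (p i) = y ∧
        ∃ e : ((Fin k → ℝ) × Z) ≃L[ℝ] ((Fin k → ℝ) × Z),
          (e : ((Fin k → ℝ) × Z) →L[ℝ] ((Fin k → ℝ) × Z)) =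
            fderiv ℝ (whitneyZ k hk Z) (p i)) ∧
      (∀ q : (Fin k → ℝ) × Z, whitneyZ k hk Z q = y → ∃ i, q = p i) := by
  let a : Fin (k + 1) → ℝ := fun i => (i : ℝ) - k / 2
  let Q : ℝ → ℝ[X] := fun s => ∏ i, (X - C (s * a i))
  have hm (s : ℝ) : (Q s).Monic := monic_prod_X_sub_C _ _
  have hd (s : ℝ) : (Q s).natDegree = k + 1 := by
    refine (natDegree_prod_of_monic _ _ fun i _ => monic_X_sub_C _).trans ?_
    simp only [natDegree_X_sub_C]
    simp
  have hc (s : ℝ) : (Q s).coeff k = 0 := by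
    have h := prod_X_sub_C_coeff_card_pred Finset.univ (fun i => s * a i) (by simp)
    rw [← Finset.mul_sum, sum_natCast_sub_half_eq_zero] at h
    simpa only [Finset.card_univ, Fintype.card_fin, Nat.add_sub_cancel, mul_zero, neg_zero]
      using h
  have hcoeff (j : ℕ) : Continuous fun s => (Q s).coeff j :=
    continuous_coeff_prod_X_sub_C _ a j
  have hcoeff₀ {j : ℕ} (hj : j < k + 1) : (Q 0).coeff j = 0 := by
    simp [Q, coeff_X_pow, hj.ne]
  have hpoint₀ : whitneyPoint k 0 (Q 0).coeff = 0 := by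
    funext j
    simp [whitneyPoint, hcoeff₀ (j.isLt.trans k.lt_succ_self)]
  have hmem (t : ℝ → ℝ) (ht : Continuous t) (ht₀ : t 0 = 0) (W : Set ((Fin k → ℝ) × Z))
      (hW : W ∈ 𝓝 0) : ∀ᶠ s in 𝓝[>] 0, (whitneyPoint k (t s) (Q s).coeff, (0 : Z)) ∈ W := by
    have h : Continuous fun s => (whitneyPoint k (t s) (Q s).coeff, (0 : Z)) :=
      (continuous_whitneyPoint ht hcoeff).prodMk continuous_const
    refine nhdsWithin_le_nhds (h.continuousAt.preimage_mem_nhds ?_)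
    rw [ht₀, hpoint₀]
    exact hW
  obtain ⟨s, ⟨hsV, hsU⟩, hs⟩ :=
    (((hmem (fun s => -(Q s).coeff 0) (hcoeff 0).neg (by simp [hcoeff₀]) V hV).and
      (eventually_all.2 fun i => hmem (fun s => s * a i) (by fun_prop) (by simp) U hU)).and
      self_mem_nhdsWithin).exists
  have hs₀ : s ≠ 0 := ne_of_gt hs
  have hinj : Function.Injective fun i => s * a i := fun i j hij => by
    simpa [a, hs₀, Fin.ext_iff] using hij
  have hroot (i : Fin (k + 1)) : (Q s).eval (s * a i) = 0 := by
    simp only [Q, eval_prod]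
    exact Finset.prod_eq_zero (Finset.mem_univ i) (by simp)
  refine ⟨_, hsV, fun i => (whitneyPoint k (s * a i) (Q s).coeff, 0), fun i j hij => hinj ?_,
    fun i => ⟨hsU i, ?_, ?_⟩, ?_⟩
  · simpa [whitneyPoint_zero] using congrFun (congrArg Prod.fst hij) ⟨0, hk⟩
  · simp [whitneyZ, whitney_whitneyPoint hk (hm s) (hd s) (hc s), hroot]
  · refine exists_equiv_eq_fderiv_whitneyZ hk (hm s) (hd s) (hc s) ?_ 0
    have h := Lagrange.eval_nodal_derivative_eval_node_eq (v := fun i => s * a i)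
      (Finset.mem_univ i)
    rw [Lagrange.eval_nodal] at h
    refine ne_of_eq_of_ne h (Finset.prod_ne_zero_iff.2 fun j hj => sub_ne_zero.2 ?_)
    exact fun hij => (Finset.mem_erase.1 hj).1 (hinj hij).symm
  · rintro ⟨x, z⟩ hq
    obtain ⟨hx, rfl⟩ := Prod.mk.inj hq
    have hpt := eq_whitneyPoint_of_whitney_eq hk hx
    rw [hpt, whitney_whitneyPoint hk (hm s) (hd s) (hc s)] at hx
    have h₀ : (Q s).eval (x ⟨0, hk⟩) = 0 := by
      have h := congrFun hx ⟨0, hk⟩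
      simp only [whitneyPoint_zero] at h
      linarith
    simp only [Q, eval_prod, Finset.prod_eq_zero_iff] at h₀
    obtain ⟨i, -, hi⟩ := h₀
    have hi' : x ⟨0, hk⟩ = s * a i := by simpa [sub_eq_zero] using hi
    exact ⟨i, by simpa only [← hi', Prod.mk.injEq, and_true] using hpt⟩
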